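/- Let α = 1 and β > 0, let φ be an analytic self-map of the open unit disk D, and let g be analytic on D. Then the operator C_φV_g, defined by (C_φV_g f)(z) = ∫₀^{φ(z)} f'(ξ) g(ξ) dξ, is bounded from Z^1 to Z^β if and only if sup_{z∈D} (1−|z|²)^β |g(φ(z)) (φ'(z))²| / (1−|φ(z)|²) < ∞ and sup_{z∈D} (1−|z|²)^β log(2/(1−|φ(z)|²)) |g'(φ(z))(φ'(z))² + g(φ(z))φ''(z)| < ∞. -/

import Mathlib

noncomputable section

/-- The open unit disk in the complex plane. -/
def uD : Set ℂ := Metric.ball 0 1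

/-- The Zygmund-type quantity `(1-|z|^2)^a * |f''(z)|`. -/
def zygS (a : ℝ) (f : ℂ → ℂ) (z : ℂ) : ℝ := (1 - ‖z‖ ^ 2) ^ a * ‖deriv (deriv f) z‖

/-- Membership in the Zygmund-type space `Z^a`. -/
def memZ (a : ℝ) (f : ℂ → ℂ) : Prop :=
  AnalyticOn ℂ f uD ∧ ∃ M : ℝ, ∀ z ∈ uD, zygS a f z ≤ M

/-- The Zygmund-type norm `‖f‖_{Z^a} = |f 0| + |f' 0| + sup_{z ∈ D} (1-|z|^2)^a |f''(z)|`. -/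
def zNorm (a : ℝ) (f : ℂ → ℂ) : ℝ := ‖f 0‖ + ‖deriv f 0‖ + sSup (zygS a f '' uD)

/-- Membership in the weighted space `H^∞_{v_b}` (for `u` analytic on `uD`). -/
def memHv (b : ℝ) (u : ℂ → ℂ) : Prop :=
  ∃ M : ℝ, ∀ z ∈ uD, (1 - ‖z‖ ^ 2) ^ b * ‖u z‖ ≤ M

/-- `T` is a bounded operator from `Z^a` to `Z^b`. -/
def boundedOp (a b : ℝ) (T : (ℂ → ℂ) → ℂ → ℂ) : Prop :=
  (∀ f, memZ a f → memZ b (T f)) ∧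
    ∃ C > 0, ∀ f, memZ a f → zNorm b (T f) ≤ C * zNorm a f

/-- `(C_φ V_g f)(z) = ∫₀^{φ(z)} f'(ξ) g(ξ) dξ`, parametrized along the segment from `0` to `φ z`. -/
def CphiVg (g φ : ℂ → ℂ) (f : ℂ → ℂ) : ℂ → ℂ :=
  fun z => ∫ t in (0:ℝ)..1, φ z * (deriv f ((t : ℂ) * φ z) * g ((t : ℂ) * φ z))

lemma uD_open : IsOpen uD := Metric.isOpen_ball

lemma mem_uD {z : ℂ} : z ∈ uD ↔ ‖z‖ < 1 := by simp [uD]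

lemma zero_mem_uD : (0:ℂ) ∈ uD := by simp [uD]

lemma smul_mem_uD {w : ℂ} (hw : w ∈ uD) {t : ℝ} (h0 : 0 ≤ t) (h1 : t ≤ 1) :
    (t:ℂ) * w ∈ uD := by
  rw [mem_uD] at *
  rw [norm_mul, Complex.norm_real, Real.norm_of_nonneg h0]
  nlinarith [norm_nonneg w]

lemma an_hasDeriv {f : ℂ → ℂ} (hf : AnalyticOn ℂ f uD) {z : ℂ} (hz : z ∈ uD) :
    HasDerivAt f (deriv f z) z :=
  (((Complex.analyticOn_iff_differentiableOn uD_open).1 hf).differentiableAt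
    (uD_open.mem_nhds hz)).hasDerivAt

lemma an_deriv {f : ℂ → ℂ} (hf : AnalyticOn ℂ f uD) : AnalyticOn ℂ (deriv f) uD :=
  (Complex.analyticOn_iff_differentiableOn uD_open).2
    (((Complex.analyticOn_iff_differentiableOn uD_open).1 hf).deriv uD_open)

lemma an_of_hasDeriv {f f' : ℂ → ℂ} (h : ∀ z ∈ uD, HasDerivAt f (f' z) z) :
    AnalyticOn ℂ f uD :=
  (Complex.analyticOn_iff_differentiableOn uD_open).2
    fun z hz => (h z hz).differentiableAt.differentiableWithinAt

lemma exists_prim {h : ℂ → ℂ} (hh : AnalyticOn ℂ h uD) :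
    ∃ F : ℂ → ℂ, F 0 = 0 ∧ ∀ z ∈ uD, HasDerivAt F (h z) z := by
  obtain ⟨F, hF⟩ := ((Complex.analyticOn_iff_differentiableOn uD_open).1 hh).isExactOn_ball
  exact ⟨fun z => F z - F 0, by simp, fun z hz => (hF z hz).sub_const _⟩

lemma deriv2_of {f f' f'' : ℂ → ℂ} (h : ∀ z ∈ uD, HasDerivAt f (f' z) z)
    (h2 : ∀ z ∈ uD, HasDerivAt f' (f'' z) z) {z : ℂ} (hz : z ∈ uD) :
    deriv (deriv f) z = f'' z := by
  have : deriv f =ᶠ[nhds z] f' := by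
    filter_upwards [uD_open.mem_nhds hz] with y hy using (h y hy).deriv
  rw [this.deriv_eq, (h2 z hz).deriv]

lemma line_hasDeriv {F : ℂ → ℂ} {c w : ℂ} {t : ℝ} (h : HasDerivAt F c ((t:ℂ) * w)) :
    HasDerivAt (fun s : ℝ => F ((s:ℂ) * w)) (w * c) t := by
  have h1 : HasDerivAt (fun s : ℂ => s * w) w (t:ℂ) := by
    simpa using (hasDerivAt_id (t:ℂ)).mul_const w
  have := (HasDerivAt.comp (t:ℂ) h h1).comp_ofReal
  rw [mul_comm]; exact this

lemma T_eq {g φ f F : ℂ → ℂ} (hf : AnalyticOn ℂ f uD) (hg : AnalyticOn ℂ g uD)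
    (hφm : Set.MapsTo φ uD uD) (hF0 : F 0 = 0)
    (hF : ∀ z ∈ uD, HasDerivAt F (deriv f z * g z) z) {z : ℂ} (hz : z ∈ uD) :
    CphiVg g φ f z = F (φ z) := by
  have hw := hφm hz
  unfold CphiVg
  rw [intervalIntegral.integral_eq_sub_of_hasDerivAt (f := fun s : ℝ => F ((s:ℂ) * φ z))]
  · simp [hF0]
  · intro t ht
    rw [Set.uIcc_of_le zero_le_one] at ht
    exact line_hasDeriv (hF _ (smul_mem_uD hw ht.1 ht.2))
  · apply ContinuousOn.intervalIntegrable
    rw [Set.uIcc_of_le zero_le_one]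
    have hm : Set.MapsTo (fun t : ℝ => (t:ℂ) * φ z) (Set.Icc 0 1) uD :=
      fun t ht => smul_mem_uD hw ht.1 ht.2
    have hc : ContinuousOn (fun t : ℝ => (t:ℂ) * φ z) (Set.Icc 0 1) := by fun_prop
    exact continuousOn_const.mul
      (((an_deriv hf).continuousOn.comp hc hm).mul (hg.continuousOn.comp hc hm))

lemma T_hasDeriv {g φ f : ℂ → ℂ} (hf : AnalyticOn ℂ f uD) (hg : AnalyticOn ℂ g uD)
    (hφ : AnalyticOn ℂ φ uD) (hφm : Set.MapsTo φ uD uD) {z : ℂ} (hz : z ∈ uD) :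
    HasDerivAt (CphiVg g φ f) (deriv f (φ z) * g (φ z) * deriv φ z) z := by
  obtain ⟨F, hF0, hF⟩ := exists_prim ((an_deriv hf).mul hg)
  have h1 : HasDerivAt (fun z => F (φ z)) (deriv f (φ z) * g (φ z) * deriv φ z) z :=
    (hF _ (hφm hz)).comp z (an_hasDeriv hφ hz)
  refine h1.congr_of_eventuallyEq ?_
  filter_upwards [uD_open.mem_nhds hz] with y hy using T_eq hf hg hφm hF0 hF hy

lemma T_deriv2 {g φ f : ℂ → ℂ} (hf : AnalyticOn ℂ f uD) (hg : AnalyticOn ℂ g uD)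
    (hφ : AnalyticOn ℂ φ uD) (hφm : Set.MapsTo φ uD uD) {z : ℂ} (hz : z ∈ uD) :
    deriv (deriv (CphiVg g φ f)) z = deriv (deriv f) (φ z) * (g (φ z) * (deriv φ z) ^ 2) +
      deriv f (φ z) * (deriv g (φ z) * (deriv φ z) ^ 2 + g (φ z) * deriv (deriv φ) z) := by
  refine deriv2_of (f' := fun z => deriv f (φ z) * g (φ z) * deriv φ z)
    (f'' := fun z => deriv (deriv f) (φ z) * (g (φ z) * (deriv φ z) ^ 2) +
      deriv f (φ z) * (deriv g (φ z) * (deriv φ z) ^ 2 + g (φ z) * deriv (deriv φ) z))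
    (fun z hz => T_hasDeriv hf hg hφ hφm hz) ?_ hz
  intro z hz
  have a := (an_hasDeriv (an_deriv hf) (hφm hz)).comp z (an_hasDeriv hφ hz)
  have b := (an_hasDeriv hg (hφm hz)).comp z (an_hasDeriv hφ hz)
  have c := an_hasDeriv (an_deriv hφ) hz
  refine HasDerivAt.congr_deriv ((a.mul b).mul c) ?_
  simp only [Function.comp, Pi.mul_apply]
  ring

lemma one_sub_sq_pos {z : ℂ} (hz : z ∈ uD) : 0 < 1 - ‖z‖ ^ 2 := by
  rw [mem_uD] at hz
  nlinarith [norm_nonneg z]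

lemma zygS_nonneg {a : ℝ} {f : ℂ → ℂ} {z : ℂ} (hz : z ∈ uD) : 0 ≤ zygS a f z :=
  mul_nonneg (Real.rpow_nonneg (one_sub_sq_pos hz).le _) (norm_nonneg _)

lemma zygS_le_sSup {a : ℝ} {f : ℂ → ℂ} (hf : memZ a f) {z : ℂ} (hz : z ∈ uD) :
    zygS a f z ≤ sSup (zygS a f '' uD) := by
  obtain ⟨M, hM⟩ := hf.2
  refine le_csSup ⟨M, ?_⟩ ⟨z, hz, rfl⟩
  rintro _ ⟨y, hy, rfl⟩
  exact hM y hy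

lemma sSup_le_of {a : ℝ} {f : ℂ → ℂ} {M : ℝ} (h : ∀ z ∈ uD, zygS a f z ≤ M) :
    sSup (zygS a f '' uD) ≤ M := by
  refine csSup_le ⟨_, 0, zero_mem_uD, rfl⟩ ?_
  rintro _ ⟨y, hy, rfl⟩
  exact h y hy

lemma log_ge {w : ℂ} (hw : w ∈ uD) : 1 / 2 ≤ Real.log (2 / (1 - ‖w‖ ^ 2)) := by
  have h := one_sub_sq_pos hw
  have h2 := Real.log_two_gt_d9
  have : Real.log 2 ≤ Real.log (2 / (1 - ‖w‖ ^ 2)) := by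
    apply Real.log_le_log (by norm_num)
    rw [le_div_iff₀ h]
    nlinarith [sq_nonneg ‖w‖]
  linarith

lemma growth {f : ℂ → ℂ} (hf : AnalyticOn ℂ f uD) {N : ℝ} (hN : ∀ z ∈ uD, zygS 1 f z ≤ N)
    {w : ℂ} (hw : w ∈ uD) :
    ‖deriv f w‖ ≤ Real.log (2 / (1 - ‖w‖ ^ 2)) * (2 * ‖deriv f 0‖ + N) := by
  have hr1 := mem_uD.1 hw
  have hr0 := norm_nonneg w
  have hN0 : 0 ≤ N := (zygS_nonneg zero_mem_uD).trans (hN 0 zero_mem_uD)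
  set r := ‖w‖ with hr
  have hd : ∀ t ∈ Set.Icc (0:ℝ) 1,
      HasDerivAt (fun s : ℝ => deriv f ((s:ℂ) * w)) (w * deriv (deriv f) ((t:ℂ) * w)) t :=
    fun t ht => line_hasDeriv (an_hasDeriv (an_deriv hf) (smul_mem_uD hw ht.1 ht.2))
  have hB : ∀ t ∈ Set.Icc (0:ℝ) 1,
      HasDerivAt (fun s : ℝ => ‖deriv f 0‖ + N / 2 * (Real.log (1 + s * r) - Real.log (1 - s * r)))
        (N / 2 * (r / (1 + t * r) - (-r) / (1 - t * r))) t := by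
    intro t ht
    have p1 : 1 + t * r ≠ 0 := by nlinarith [ht.1]
    have p2 : 1 - t * r ≠ 0 := by nlinarith [ht.1, ht.2]
    have h1 : HasDerivAt (fun s : ℝ => s * r) r t := by
      simpa using (hasDerivAt_id t).mul_const r
    exact ((((h1.const_add 1).log p1).sub ((h1.const_sub 1).log p2)).const_mul (N/2)).const_add _
  have key := image_norm_le_of_norm_deriv_right_le_deriv_boundary'
    (f := fun s : ℝ => deriv f ((s:ℂ) * w)) (a := 0) (b := 1)
    (fun t ht => (hd t ht).continuousAt.continuousWithinAt)
    (fun t ht => (hd t ⟨ht.1, ht.2.le⟩).hasDerivWithinAt)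
    (B := fun s : ℝ => ‖deriv f 0‖ + N / 2 * (Real.log (1 + s * r) - Real.log (1 - s * r)))
    (by simp)
    (fun t ht => (hB t ht).continuousAt.continuousWithinAt)
    (fun t ht => (hB t ⟨ht.1, ht.2.le⟩).hasDerivWithinAt) ?_
    (Set.right_mem_Icc.2 zero_le_one)
  · simp only [Complex.ofReal_one, one_mul] at key
    have hp := one_sub_sq_pos hw
    rw [← hr] at hp
    have hL := log_ge hw
    rw [← hr] at hL
    have h3 : Real.log (1 + r) - Real.log (1 - r) ≤ 2 * Real.log (2 / (1 - r ^ 2)) := by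
      rw [← Real.log_div (by linarith) (by linarith)]
      have : 2 * Real.log (2 / (1 - r ^ 2)) = Real.log ((2 / (1 - r ^ 2)) ^ 2) := by
        rw [Real.log_pow]; norm_num
      rw [this]
      apply Real.log_le_log (div_pos (by linarith) (by linarith))
      rw [div_pow, div_le_div_iff₀ (by linarith) (by positivity)]
      have : (1 + r) * (1 - r ^ 2) ^ 2 = (1 - r) * ((1 + r) ^ 3 * (1 - r)) := by ring
      rw [this, mul_comm]
      apply mul_le_mul_of_nonneg_right _ (by linarith)
      have : (1 + r) ^ 2 ≤ 2 ^ 2 := by gcongr; linarith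
      nlinarith
    have h4 := mul_le_mul_of_nonneg_left h3 (by positivity : 0 ≤ N / 2)
    have h5 := mul_le_mul_of_nonneg_right hL (norm_nonneg (deriv f 0))
    nlinarith
  · intro t ht
    have htw := smul_mem_uD hw ht.1 ht.2.le
    have h1 := hN _ htw
    have h2 := one_sub_sq_pos htw
    unfold zygS at h1
    rw [Real.rpow_one] at h1
    have e : ‖(t:ℂ) * w‖ = t * r := by
      rw [norm_mul, Complex.norm_real, Real.norm_of_nonneg ht.1]
    rw [e] at h1 h2
    have p1 : 0 < 1 + t * r := by nlinarith [ht.1]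
    have p2 : 0 < 1 - t * r := by nlinarith [ht.1, ht.2]
    have : N / 2 * (r / (1 + t * r) - (-r) / (1 - t * r)) = r * (N / (1 - (t * r) ^ 2)) := by
      have : 1 - (t * r) ^ 2 = (1 + t * r) * (1 - t * r) := by ring
      rw [this]
      have p1' := p1.ne'
      have p2' := p2.ne'
      rw [div_sub_div _ _ p1' p2', ← mul_div_assoc, ← mul_div_assoc]
      congr 1
      ring
    rw [this, norm_mul]
    apply mul_le_mul_of_nonneg_left _ hr0
    rw [le_div_iff₀ h2]
    linarith

lemma re_pos {a u : ℂ} (ha : a ∈ uD) (hu : u ∈ uD) :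
    0 < (1 - (starRingEnd ℂ) a * u).re := by
  rw [mem_uD] at *
  have h := Complex.re_le_norm ((starRingEnd ℂ) a * u)
  rw [norm_mul, Complex.norm_conj] at h
  have : ‖a‖ * ‖u‖ < 1 := by nlinarith [norm_nonneg a, norm_nonneg u]
  simp only [Complex.sub_re, Complex.one_re]
  linarith

lemma norm_ge {a u : ℂ} : 1 - ‖a‖ * ‖u‖ ≤ ‖1 - (starRingEnd ℂ) a * u‖ := by
  have h := norm_sub_norm_le 1 ((starRingEnd ℂ) a * u)
  rw [norm_mul, Complex.norm_conj, norm_one] at h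
  exact h

lemma conj_mul_self (a : ℂ) : 1 - (starRingEnd ℂ) a * a = ((1 - ‖a‖ ^ 2 : ℝ) : ℂ) := by
  rw [Complex.conj_mul']
  push_cast
  ring

/-- Test functions: a bounded operator estimate for a primitive of `h`. -/
lemma testFn_bound {β : ℝ} {g φ : ℂ → ℂ} (hφ : AnalyticOn ℂ φ uD) (hφm : Set.MapsTo φ uD uD)
    (hg : AnalyticOn ℂ g uD) {C : ℝ} (hC : 0 < C)
    (hm : ∀ f, memZ 1 f → memZ β (CphiVg g φ f))
    (hb : ∀ f, memZ 1 f → zNorm β (CphiVg g φ f) ≤ C * zNorm 1 f)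
    {h h' : ℂ → ℂ} (hh : ∀ z ∈ uD, HasDerivAt h (h' z) z) {K : ℝ}
    (hK : ∀ z ∈ uD, (1 - ‖z‖ ^ 2) * ‖h' z‖ ≤ K) (h0 : ‖h 0‖ ≤ 1) {z : ℂ} (hz : z ∈ uD) :
    (1 - ‖z‖ ^ 2) ^ β * ‖h' (φ z) * (g (φ z) * (deriv φ z) ^ 2) +
      h (φ z) * (deriv g (φ z) * (deriv φ z) ^ 2 + g (φ z) * deriv (deriv φ) z)‖
      ≤ C * (1 + K) := by
  obtain ⟨f, hf0, hf⟩ := exists_prim (an_of_hasDeriv hh)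
  have hfa := an_of_hasDeriv hf
  have hS : ∀ z ∈ uD, zygS 1 f z ≤ K := by
    intro z hz
    unfold zygS
    rw [deriv2_of hf hh hz, Real.rpow_one]
    exact hK z hz
  have hfm : memZ 1 f := ⟨hfa, K, hS⟩
  have hn : zNorm 1 f ≤ 1 + K := by
    unfold zNorm
    rw [hf0, (hf 0 zero_mem_uD).deriv, norm_zero]
    linarith [sSup_le_of hS]
  have h1 := zygS_le_sSup (hm f hfm) hz
  have h2 := hb f hfm
  have h3 := mul_le_mul_of_nonneg_left hn hC.le
  have h4 : zygS β (CphiVg g φ f) z ≤ zNorm β (CphiVg g φ f) := by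
    have e1 := norm_nonneg (CphiVg g φ f 0)
    have e2 := norm_nonneg (deriv (CphiVg g φ f) 0)
    unfold zNorm; linarith
  have h5 : zygS β (CphiVg g φ f) z ≤ C * (1 + K) := by linarith
  unfold zygS at h5
  rwa [T_deriv2 hfa hg hφ hφm hz, deriv2_of hf hh (hφm hz), (hf _ (hφm hz)).deriv] at h5

lemma frac_bd {r s n : ℝ} (hr0 : 0 ≤ r) (hr : r < 1) (hs0 : 0 ≤ s) (hs : s < 1)
    (hn : 1 - r * s ≤ n) : 1 - s ^ 2 ≤ 2 * n := by nlinarith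

lemma necessity {β : ℝ} {g φ : ℂ → ℂ} (hφ : AnalyticOn ℂ φ uD) (hφm : Set.MapsTo φ uD uD)
    (hg : AnalyticOn ℂ g uD) {C : ℝ} (hC : 0 < C)
    (hm : ∀ f, memZ 1 f → memZ β (CphiVg g φ f))
    (hb : ∀ f, memZ 1 f → zNorm β (CphiVg g φ f) ≤ C * zNorm 1 f) {z : ℂ} (hz : z ∈ uD) :
    (1 - ‖z‖ ^ 2) ^ β * ‖g (φ z) * (deriv φ z) ^ 2‖ / (1 - ‖φ z‖ ^ 2) ≤ C * 5 ∧
    (1 - ‖z‖ ^ 2) ^ β * Real.log (2 / (1 - ‖φ z‖ ^ 2)) *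
      ‖deriv g (φ z) * (deriv φ z) ^ 2 + g (φ z) * deriv (deriv φ) z‖ ≤ C * 8 := by
  have hw := hφm hz
  have hwp := one_sub_sq_pos hw
  have hW : 0 ≤ (1 - ‖z‖ ^ 2) ^ β := Real.rpow_nonneg (one_sub_sq_pos hz).le _
  set a := φ z with ha
  set c := (starRingEnd ℂ) a with hc
  have hne : ∀ u ∈ uD, 1 - c * u ≠ 0 := by
    intro u hu h
    have := re_pos hw hu
    rw [← hc, h] at this
    simp at this
  have hlin : ∀ u : ℂ, HasDerivAt (fun u : ℂ => 1 - c * u) (-c) u := by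
    intro u
    simpa using ((hasDerivAt_id u).const_mul c).const_sub 1
  have hself : 1 - c * a = ((1 - ‖a‖ ^ 2 : ℝ) : ℂ) := conj_mul_self a
  have hca : ‖c‖ = ‖a‖ := Complex.norm_conj a
  have ha1 := mem_uD.1 hw
  have T1 := testFn_bound hφ hφm hg hC hm hb (h := fun u => (u - a) / (1 - c * u))
    (h' := fun u => ((1 - ‖a‖ ^ 2 : ℝ) : ℂ) / (1 - c * u) ^ 2) (K := 4) ?_ ?_ ?_ hz
  have T2 := testFn_bound hφ hφm hg hC hm hb (h := fun u => (Real.log 2 : ℂ) - Complex.log (1 - c * u))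
    (h' := fun u => c / (1 - c * u)) (K := 2) ?_ ?_ ?_ hz
  · rw [← ha] at T1 T2
    have e1 : ((1 - ‖a‖ ^ 2 : ℝ) : ℂ) / (1 - c * a) ^ 2 = ((1 / (1 - ‖a‖ ^ 2) : ℝ) : ℂ) := by
      rw [hself]
      push_cast
      have : ((1 - ‖a‖ ^ 2 : ℝ) : ℂ) ≠ 0 := by exact_mod_cast hwp.ne'
      push_cast at this
      field_simp
    have e2 : (Real.log 2 : ℂ) - Complex.log (1 - c * a) =
        (Real.log (2 / (1 - ‖a‖ ^ 2)) : ℂ) := by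
      rw [hself, ← Complex.ofReal_log hwp.le, Real.log_div (by norm_num) hwp.ne']
      push_cast; rfl
    have hL := log_ge hw
    set A := g a * (deriv φ z) ^ 2 with hA
    set B := deriv g a * (deriv φ z) ^ 2 + g a * deriv (deriv φ) z with hB
    have T1' : (1 - ‖z‖ ^ 2) ^ β * ‖A‖ / (1 - ‖a‖ ^ 2) ≤ C * 5 := by
      simp only [sub_self, zero_div, zero_mul, add_zero] at T1
      rw [e1, norm_mul, Complex.norm_real, Real.norm_of_nonneg (by positivity)] at T1
      calc _ = (1 - ‖z‖ ^ 2) ^ β * (1 / (1 - ‖a‖ ^ 2) * ‖A‖) := by ring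
        _ ≤ _ := T1
        _ = _ := by norm_num
    refine ⟨T1', ?_⟩
    rw [e2, hself] at T2
    have n1 : ‖c / ((1 - ‖a‖ ^ 2 : ℝ) : ℂ) * A‖ ≤ ‖A‖ / (1 - ‖a‖ ^ 2) := by
      rw [norm_mul, norm_div, Complex.norm_real, Real.norm_of_nonneg hwp.le, hca,
        div_mul_eq_mul_div]
      gcongr
      nlinarith [norm_nonneg A]
    have n2 : Real.log (2 / (1 - ‖a‖ ^ 2)) * ‖B‖ ≤
        ‖c / ((1 - ‖a‖ ^ 2 : ℝ) : ℂ) * A + (Real.log (2 / (1 - ‖a‖ ^ 2)) : ℂ) * B‖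
          + ‖c / ((1 - ‖a‖ ^ 2 : ℝ) : ℂ) * A‖ := by
      have := norm_sub_le (c / ((1 - ‖a‖ ^ 2 : ℝ) : ℂ) * A +
        (Real.log (2 / (1 - ‖a‖ ^ 2)) : ℂ) * B) (c / ((1 - ‖a‖ ^ 2 : ℝ) : ℂ) * A)
      rw [add_sub_cancel_left, norm_mul (Real.log (2 / (1 - ‖a‖ ^ 2)) : ℂ), Complex.norm_real,
        Real.norm_of_nonneg (by linarith)] at this
      exact this
    have n3 := mul_le_mul_of_nonneg_left (n2.trans (add_le_add_right n1 _)) hW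
    rw [mul_add] at n3
    rw [mul_div_assoc] at T1'
    rw [mul_assoc]
    linarith
  · intro u hu
    have := (hasDerivAt_const u (Real.log 2 : ℂ)).sub
      ((hlin u).clog (Or.inl (re_pos hw hu)))
    refine HasDerivAt.congr_deriv this ?_
    ring
  · intro u hu
    have hu1 := mem_uD.1 hu
    have hn : 1 - ‖a‖ * ‖u‖ ≤ ‖1 - c * u‖ := norm_ge
    have hnp : 0 < ‖1 - c * u‖ := norm_pos_iff.2 (hne u hu)
    have := frac_bd (norm_nonneg a) ha1 (norm_nonneg u) hu1 hn
    rw [norm_div, ← mul_div_assoc, div_le_iff₀ hnp, hca]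
    have := one_sub_sq_pos hu
    nlinarith [norm_nonneg a]
  · simp only [mul_zero, sub_zero, Complex.log_one, Complex.norm_real]
    rw [Real.norm_of_nonneg (Real.log_nonneg (by norm_num))]
    linarith [Real.log_two_lt_d9]
  · intro u hu
    have := ((hasDerivAt_id u).sub_const a).div (hlin u) (hne u hu)
    refine HasDerivAt.congr_deriv this ?_
    rw [← hself]
    simp only [id]
    ring
  · intro u hu
    have hu1 := mem_uD.1 hu
    have hn : 1 - ‖a‖ * ‖u‖ ≤ ‖1 - c * u‖ := norm_ge
    have hnp : 0 < ‖1 - c * u‖ := norm_pos_iff.2 (hne u hu)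
    have q1 := frac_bd (norm_nonneg a) ha1 (norm_nonneg u) hu1 hn
    rw [mul_comm] at hn
    have q2 := frac_bd (norm_nonneg u) hu1 (norm_nonneg a) ha1 hn
    rw [norm_div, Complex.norm_real, Real.norm_of_nonneg hwp.le, norm_pow, ← mul_div_assoc,
      div_le_iff₀ (by positivity)]
    have := mul_le_mul q1 q2 hwp.le (by positivity)
    linarith
  · simp only [mul_zero, sub_zero, zero_sub, div_one, norm_neg]
    exact ha1.le

lemma sufficiency {β : ℝ} {g φ : ℂ → ℂ} (hφ : AnalyticOn ℂ φ uD) (hφm : Set.MapsTo φ uD uD)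
    (hg : AnalyticOn ℂ g uD) {M₁ M₂ : ℝ}
    (h1 : ∀ z ∈ uD, (1 - ‖z‖ ^ 2) ^ β * ‖g (φ z) * (deriv φ z) ^ 2‖ / (1 - ‖φ z‖ ^ 2) ≤ M₁)
    (h2 : ∀ z ∈ uD, (1 - ‖z‖ ^ 2) ^ β * Real.log (2 / (1 - ‖φ z‖ ^ 2)) *
      ‖deriv g (φ z) * (deriv φ z) ^ 2 + g (φ z) * deriv (deriv φ) z‖ ≤ M₂) :
    boundedOp 1 β (CphiVg g φ) := by
  have main : ∀ f, memZ 1 f → ∀ z ∈ uD, zygS β (CphiVg g φ f) z ≤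
      M₁ * sSup (zygS 1 f '' uD) + M₂ * (2 * ‖deriv f 0‖ + sSup (zygS 1 f '' uD)) := by
    intro f hf z hz
    have hw := hφm hz
    have hwp := one_sub_sq_pos hw
    have hW : 0 ≤ (1 - ‖z‖ ^ 2) ^ β := Real.rpow_nonneg (one_sub_sq_pos hz).le _
    set N := sSup (zygS 1 f '' uD) with hN
    have hS : ∀ z ∈ uD, zygS 1 f z ≤ N := fun z hz => zygS_le_sSup hf hz
    have hN0 : 0 ≤ N := (zygS_nonneg zero_mem_uD).trans (hS 0 zero_mem_uD)
    have gr := growth hf.1 hS hw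
    have s := hS _ hw
    unfold zygS at s ⊢
    rw [Real.rpow_one] at s
    rw [T_deriv2 hf.1 hg hφ hφm hz]
    have a1 := mul_le_mul_of_nonneg_right (h1 z hz) hN0
    have a2 := mul_le_mul_of_nonneg_right (h2 z hz)
      (by positivity : 0 ≤ 2 * ‖deriv f 0‖ + N)
    refine le_trans ?_ (add_le_add a1 a2)
    have s' : ‖deriv (deriv f) (φ z)‖ ≤ N / (1 - ‖φ z‖ ^ 2) := by
      rw [le_div_iff₀ hwp]; linarith
    set A := g (φ z) * (deriv φ z) ^ 2
    set B := deriv g (φ z) * (deriv φ z) ^ 2 + g (φ z) * deriv (deriv φ) z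
    calc _ ≤ (1 - ‖z‖ ^ 2) ^ β * (N / (1 - ‖φ z‖ ^ 2) * ‖A‖ +
          Real.log (2 / (1 - ‖φ z‖ ^ 2)) * (2 * ‖deriv f 0‖ + N) * ‖B‖) := by
          apply mul_le_mul_of_nonneg_left _ hW
          refine (norm_add_le _ _).trans ?_
          rw [norm_mul, norm_mul (deriv f (φ z))]
          gcongr
      _ = _ := by ring
  have hT : ∀ f, memZ 1 f → memZ β (CphiVg g φ f) := fun f hf =>
    ⟨an_of_hasDeriv (fun z hz => T_hasDeriv hf.1 hg hφ hφm hz), _, main f hf⟩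
  refine ⟨hT, ?_⟩
  have hw := hφm zero_mem_uD
  set w := φ 0 with hw'
  have hwp := one_sub_sq_pos hw
  set L := Real.log (2 / (1 - ‖w‖ ^ 2)) with hL
  have hL0 : 0 ≤ L := by linarith [log_ge hw]
  obtain ⟨G, hG⟩ : ∃ G, ∀ t ∈ Set.Icc (0:ℝ) 1, ‖g ((t:ℂ) * w)‖ ≤ G := by
    apply isCompact_Icc.exists_bound_of_continuousOn
    exact hg.continuousOn.comp (by fun_prop) (fun t ht => smul_mem_uD hw ht.1 ht.2)
  have hG0 : 0 ≤ G := (norm_nonneg _).trans (hG 0 (by simp))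
  refine ⟨L * 2 * G + L * 2 * (‖g w‖ * ‖deriv φ 0‖) + |M₁| + |M₂| * 2 + 1, by positivity, ?_⟩
  intro f hf
  have ms := sSup_le_of (main f hf)
  have hS : ∀ z ∈ uD, zygS 1 f z ≤ sSup (zygS 1 f '' uD) := fun z hz => zygS_le_sSup hf hz
  have hN0 : 0 ≤ sSup (zygS 1 f '' uD) :=
    (zygS_nonneg zero_mem_uD).trans (hS 0 zero_mem_uD)
  have hZ : zNorm 1 f = ‖f 0‖ + ‖deriv f 0‖ + sSup (zygS 1 f '' uD) := rfl
  set N := sSup (zygS 1 f '' uD) with hN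
  set Z := zNorm 1 f with hZd
  have f0 := norm_nonneg (f 0)
  have f1 := norm_nonneg (deriv f 0)
  have hZ0 : 0 ≤ Z := by linarith
  have k1 : 2 * ‖deriv f 0‖ + N ≤ 2 * Z := by linarith
  have k2 : N ≤ Z := by linarith
  have gr : ∀ t ∈ Set.Icc (0:ℝ) 1, ‖deriv f ((t:ℂ) * w)‖ ≤ L * (2 * Z) := by
    intro t ht
    have htw := smul_mem_uD hw ht.1 ht.2
    refine (growth hf.1 hS htw).trans ?_
    have e : ‖(t:ℂ) * w‖ ≤ ‖w‖ := by
      rw [norm_mul, Complex.norm_real, Real.norm_of_nonneg ht.1]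
      nlinarith [norm_nonneg w, ht.2]
    have := one_sub_sq_pos htw
    have : Real.log (2 / (1 - ‖(t:ℂ) * w‖ ^ 2)) ≤ L := by
      apply Real.log_le_log (by positivity)
      gcongr
    exact mul_le_mul this k1 (by positivity) hL0
  have b0 : ‖CphiVg g φ f 0‖ ≤ L * 2 * G * Z := by
    unfold CphiVg
    have := intervalIntegral.norm_integral_le_of_norm_le_const (a := 0) (b := 1)
      (C := L * 2 * G * Z)
      (f := fun t : ℝ => w * (deriv f ((t : ℂ) * w) * g ((t : ℂ) * w))) ?_
    · simpa using this
    · intro t ht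
      rw [Set.uIoc_of_le zero_le_one] at ht
      have ht' : t ∈ Set.Icc (0:ℝ) 1 := ⟨ht.1.le, ht.2⟩
      rw [norm_mul, norm_mul]
      have p1 := mul_le_mul (gr t ht') (hG t ht') (norm_nonneg _) (by positivity)
      have p2 : 0 ≤ ‖deriv f ((t : ℂ) * w)‖ * ‖g ((t : ℂ) * w)‖ := by positivity
      have p3 := mul_le_of_le_one_left p2 (mem_uD.1 hw).le
      linarith
  have b1 : ‖deriv (CphiVg g φ f) 0‖ ≤ L * 2 * (‖g w‖ * ‖deriv φ 0‖) * Z := by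
    rw [(T_hasDeriv hf.1 hg hφ hφm zero_mem_uD).deriv, ← hw', norm_mul, norm_mul]
    have := gr 1 (by simp)
    simp only [Complex.ofReal_one, one_mul] at this
    have := mul_le_mul_of_nonneg_right this
      (by positivity : 0 ≤ ‖g w‖ * ‖deriv φ 0‖)
    linarith
  have b2 : M₁ * N ≤ |M₁| * Z := mul_le_mul (le_abs_self _) k2 hN0 (abs_nonneg _)
  have b3 : M₂ * (2 * ‖deriv f 0‖ + N) ≤ |M₂| * (2 * Z) :=
    mul_le_mul (le_abs_self _) k1 (by positivity) (abs_nonneg _)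
  have e : zNorm β (CphiVg g φ f) = ‖CphiVg g φ f 0‖ + ‖deriv (CphiVg g φ f) 0‖ +
    sSup (zygS β (CphiVg g φ f) '' uD) := rfl
  rw [e]
  linarith

theorem stmt_4 (α β : ℝ) (hα : α = 1) (hβ : 0 < β)
    (φ g : ℂ → ℂ) (hφ : AnalyticOn ℂ φ uD) (hφm : Set.MapsTo φ uD uD)
    (hg : AnalyticOn ℂ g uD) :
    boundedOp 1 β (CphiVg g φ) ↔
      ((∃ M : ℝ, ∀ z ∈ uD, (1 - ‖z‖ ^ 2) ^ β * ‖g (φ z) * (deriv φ z) ^ 2‖ / (1 - ‖φ z‖ ^ 2) ^ (1:ℝ) ≤ M) ∧ (∃ M : ℝ, ∀ z ∈ uD, (1 - ‖z‖ ^ 2) ^ β * Real.log (2 / (1 - ‖φ z‖ ^ 2)) * ‖deriv g (φ z) * (deriv φ z) ^ 2 + g (φ z) * deriv (deriv φ) z‖ ≤ M)) := by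
  simp only [Real.rpow_one]
  constructor
  · rintro ⟨hm, C, hC, hb⟩
    exact ⟨⟨_, fun z hz => (necessity hφ hφm hg hC hm hb hz).1⟩,
      ⟨_, fun z hz => (necessity hφ hφm hg hC hm hb hz).2⟩⟩
  · rintro ⟨⟨M₁, h1⟩, ⟨M₂, h2⟩⟩
    exact sufficiency hφ hφm hg h1 h2
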